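/- Let p be a prime and let 1 ≤ i ≤ p − 2 with i ∈ T. Suppose r, s are coprime integers with 0 < r, s < √p and i·(r + s) ≡ −s (mod p). Then (x_i, y_i) = (r, s). -/

import Mathlib

/-- `xmax p i` is the unique residue in `{1, …, p-1}` with `i * xmax ≡ 1 (mod p)`
(for `1 ≤ i ≤ p - 2` and `p` prime). -/
noncomputable def xmax (p i : ℕ) : ℕ := ((i : ZMod p)⁻¹).val

/-- `ymax p i` is the unique residue in `{1, …, p-1}` with `(i+1) * ymax ≡ -1 (mod p)`
(for `1 ≤ i ≤ p - 2` and `p` prime). -/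
noncomputable def ymax (p i : ℕ) : ℕ := ((-((i : ZMod p) + 1))⁻¹).val

/-- A pair `(x, y)` of positive integers with `x ≤ xmax p i`, `y ≤ ymax p i` and
`i·x + (i+1)·y ≡ 0 (mod p)`. -/
def ValidPair (p i : ℕ) (xy : ℕ × ℕ) : Prop :=
  0 < xy.1 ∧ 0 < xy.2 ∧ xy.1 ≤ xmax p i ∧ xy.2 ≤ ymax p i ∧
    p ∣ (i * xy.1 + (i + 1) * xy.2)

-- `minPair p i = (x_i, y_i)` is the valid pair minimizing `x + y`
-- (this minimizer exists and is unique for `1 ≤ i ≤ p - 2` and `p` prime).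
open Classical in
noncomputable def minPair (p i : ℕ) : ℕ × ℕ :=
  if h : ∃ xy, ValidPair p i xy ∧
      ∀ xy', ValidPair p i xy' → xy.1 + xy.2 ≤ xy'.1 + xy'.2
  then h.choose else (0, 0)

theorem aux_le (p r s X : ℕ) (hr : 0 < r) (hs : 0 < s) (hX : 0 < X) (hrp : r * r < p)
    (hsp : s * s < p) (hcop : Nat.Coprime r s) (h : p ∣ s * (X + 1) + r) : r ≤ X := by
  by_contra hlt
  push Not at hlt
  have hle := Nat.le_of_dvd (by positivity) h
  rcases lt_trichotomy r s with h1 | h1 | h1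
  · nlinarith
  · subst h1
    have : r = 1 := by simpa using hcop
    omega
  · nlinarith

theorem aux_T (p : ℕ) (hp : p.Prime) (i : ℕ)
    (hT : ¬ ∃ r s : ℕ, 0 < r ∧ 0 < s ∧ (r : ℝ) < Real.sqrt p ∧ (s : ℝ) < Real.sqrt p ∧
      Nat.Coprime r s ∧ ¬(r = 1 ∧ s = 1) ∧
      (p : ℤ) ∣ ((i : ℤ) * ((r : ℤ) - (s : ℤ)) - (s : ℤ)))
    (a b : ℕ) (ha : 0 < a) (hb : 0 < b) (hap : a * a < p) (hbp : b * b < p)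
    (h : (p : ℤ) ∣ (i : ℤ) * a - (i + 1) * b) : False := by
  obtain ⟨g, u, v, hg, huv, rfl, rfl⟩ := Nat.exists_coprime' (m := a) (n := b) (Nat.gcd_pos_of_pos_left _ ha)
  have hu : 0 < u := Nat.pos_of_mul_pos_right ha
  have hv : 0 < v := Nat.pos_of_mul_pos_right hb
  have hgp : g < p := by nlinarith
  have hpg : ¬ (p : ℤ) ∣ g := by
    intro hd
    have := Nat.le_of_dvd hg (Int.natCast_dvd_natCast.mp hd)
    omega
  have h2 : (p : ℤ) ∣ (i : ℤ) * (u - v) - v := by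
    have h3 : (p : ℤ) ∣ ((i : ℤ) * (u - v) - v) * g := by
      convert h using 1
      push_cast; ring
    exact ((Nat.prime_iff_prime_int.mp hp).dvd_or_dvd h3).resolve_right hpg
  refine hT ⟨u, v, hu, hv, ?_, ?_, huv, ?_, h2⟩
  · apply Real.lt_sqrt_of_sq_lt
    have : u ^ 2 < p := by nlinarith [Nat.mul_le_mul (Nat.le_mul_of_pos_right u hg) (Nat.le_mul_of_pos_right u hg)]
    exact_mod_cast this
  · apply Real.lt_sqrt_of_sq_lt
    have : v ^ 2 < p := by nlinarith [Nat.mul_le_mul (Nat.le_mul_of_pos_right v hg) (Nat.le_mul_of_pos_right v hg)]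
    exact_mod_cast this
  · rintro ⟨rfl, rfl⟩
    have h1 : (p : ℤ) ∣ 1 := by simpa using h2
    exact (Nat.prime_iff_prime_int.mp hp).not_dvd_one h1

theorem aux_sqrt (p r : ℕ) (h : (r : ℝ) < Real.sqrt p) : r * r < p := by
  have := (Real.lt_sqrt (Nat.cast_nonneg r)).mp h
  rw [pow_two] at this
  exact_mod_cast this

theorem aux_dvd {p a b c : ℤ} (h1 : p ∣ a) (h2 : p ∣ b) (u v : ℤ) (e : c = u * a + v * b) :
    p ∣ c := e ▸ dvd_add (Dvd.dvd.mul_left h1 u) (Dvd.dvd.mul_left h2 v)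

theorem aux_sq {a r p : ℕ} (h : a ≤ r) (h2 : r * r < p) : a * a < p :=
  lt_of_le_of_lt (Nat.mul_le_mul h h) h2

/-- If `i ∈ T` (i.e. `i` has no representation `i ≡ s/(r-s) (mod p)` with `r, s`
coprime, `0 < r, s < √p`, not both `1`), and `i ≡ -s/(r+s) (mod p)` with `r, s`
coprime and `0 < r, s < √p`, then `(x_i, y_i) = (r, s)`. -/
theorem T_case_exact (p : ℕ) (hp : p.Prime) (i : ℕ) (hi1 : 1 ≤ i) (hi2 : i ≤ p - 2)
    (hT : ¬ ∃ r s : ℕ, 0 < r ∧ 0 < s ∧ (r : ℝ) < Real.sqrt p ∧ (s : ℝ) < Real.sqrt p ∧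
      Nat.Coprime r s ∧ ¬(r = 1 ∧ s = 1) ∧
      (p : ℤ) ∣ ((i : ℤ) * ((r : ℤ) - (s : ℤ)) - (s : ℤ)))
    (r s : ℕ) (hr : 0 < r) (hs : 0 < s)
    (hrp : (r : ℝ) < Real.sqrt p) (hsp : (s : ℝ) < Real.sqrt p)
    (hcop : Nat.Coprime r s)
    (hcong : (p : ℤ) ∣ ((i : ℤ) * ((r : ℤ) + (s : ℤ)) + (s : ℤ))) :
    minPair p i = (r, s) := by
  have hT' := aux_T p hp i hT
  have hrp' := aux_sqrt p r hrp
  have hsp' := aux_sqrt p s hsp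
  have := Fact.mk hp
  have hp2 := hp.two_le
  have hP := Nat.prime_iff_prime_int.mp hp
  have hsmall : ∀ n : ℤ, 0 < n → n < p → ¬ (p : ℤ) ∣ n := by
    intro n h0 h1 hd
    have := Int.le_of_dvd h0 hd
    omega
  have hni : ¬ (p : ℤ) ∣ (i : ℤ) := hsmall _ (by omega) (by omega)
  have hni1 : ¬ (p : ℤ) ∣ (i : ℤ) + 1 := hsmall _ (by omega) (by omega)
  have hi0 : (i : ZMod p) ≠ 0 := by
    intro h0
    exact hni ((ZMod.intCast_zmod_eq_zero_iff_dvd _ _).mp (by exact_mod_cast h0))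
  have hi10 : (i : ZMod p) + 1 ≠ 0 := by
    intro h0
    exact hni1 ((ZMod.intCast_zmod_eq_zero_iff_dvd _ _).mp (by push_cast; exact h0))
  have hX0 : 0 < xmax p i := by
    unfold xmax
    rw [Nat.pos_iff_ne_zero, Ne, ZMod.val_eq_zero]
    exact inv_ne_zero hi0
  have hY0 : 0 < ymax p i := by
    unfold ymax
    rw [Nat.pos_iff_ne_zero, Ne, ZMod.val_eq_zero]
    exact inv_ne_zero (neg_ne_zero.mpr hi10)
  have hX : (i : ZMod p) * (xmax p i : ZMod p) = 1 := by
    unfold xmax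
    rw [ZMod.natCast_zmod_val, mul_inv_cancel₀ hi0]
  have hY : ((i : ZMod p) + 1) * (ymax p i : ZMod p) = -1 := by
    unfold ymax
    rw [ZMod.natCast_zmod_val, inv_neg, mul_neg, mul_inv_cancel₀ hi10]
  have hc : (i : ZMod p) * (r + s) + s = 0 := by
    have := (ZMod.intCast_zmod_eq_zero_iff_dvd _ _).mpr hcong
    push_cast at this
    exact this
  have hrX : r ≤ xmax p i := by
    refine aux_le p r s _ hr hs hX0 hrp' hsp' hcop ?_
    rw [← ZMod.natCast_eq_zero_iff]
    push_cast
    apply (mul_eq_zero.mp _).resolve_left hi0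
    linear_combination (s : ZMod p) * hX + hc
  have hsY : s ≤ ymax p i := by
    refine aux_le p s r _ hs hr hY0 hsp' hrp' hcop.symm ?_
    rw [← ZMod.natCast_eq_zero_iff]
    push_cast
    apply (mul_eq_zero.mp _).resolve_left hi10
    linear_combination (r : ZMod p) * hY + hc
  have hv : ValidPair p i (r, s) := by
    refine ⟨hr, hs, hrX, hsY, ?_⟩
    rw [← ZMod.natCast_eq_zero_iff]
    push_cast
    linear_combination hc
  have key : ∀ xy, ValidPair p i xy → xy.1 + xy.2 ≤ r + s → xy = (r, s) := by
    rintro ⟨x, y⟩ ⟨hx, hy, -, -, hd⟩ hle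
    simp only at hx hy hd hle
    have hd' : (p : ℤ) ∣ (i : ℤ) * x + (i + 1) * y := by exact_mod_cast hd
    have hrlt : r < p := by nlinarith
    have hslt : s < p := by nlinarith
    rcases lt_trichotomy x r with h1 | h1 | h1
    · exfalso
      rcases lt_trichotomy y s with h2 | h2 | h2
      · have h3 : (p : ℤ) ∣ ((i : ℤ) + 1) * ((r : ℤ) * y - s * x) := by
          exact aux_dvd hd' hcong (r : ℤ) (-(x : ℤ)) (by ring)
        have h4 := (hP.dvd_or_dvd h3).resolve_left hni1
        have hrs : r * s < p := by
          rcases le_total r s with h | h <;> nlinarith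
        have hA : r * y < r * s := Nat.mul_lt_mul_of_pos_left h2 hr
        have hB : s * x < s * r := Nat.mul_lt_mul_of_pos_left h1 hs
        rw [mul_comm s r] at hB
        have h5 : (r : ℤ) * y - s * x = 0 := by
          apply Int.eq_zero_of_abs_lt_dvd h4
          rw [abs_lt]
          zify at hA hB hrs
          have : (0 : ℤ) ≤ r * y := by positivity
          have : (0 : ℤ) ≤ s * x := by positivity
          constructor <;> linarith
        have h6 : r * y = s * x := by zify; linarith
        have h7 : r ∣ x := hcop.dvd_of_dvd_mul_left (Dvd.intro _ h6)
        have := Nat.le_of_dvd hx h7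
        omega
      · subst h2
        have h3 : (p : ℤ) ∣ (i : ℤ) * ((r : ℤ) - x) := by
          exact aux_dvd hcong hd' 1 (-1) (by push_cast; ring)
        exact hsmall _ (by omega) (by omega) ((hP.dvd_or_dvd h3).resolve_left hni)
      · obtain ⟨a, rfl⟩ := Nat.exists_eq_add_of_lt h1
        obtain ⟨b, rfl⟩ := Nat.exists_eq_add_of_lt h2
        have hba : b ≤ a := by omega
        refine hT' (a + 1) (b + 1) (by omega) (by omega) (aux_sq (by omega) hrp') (aux_sq (by omega) hrp') ?_
        exact aux_dvd hcong hd' 1 (-1) (by push_cast; ring)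
    · subst h1
      rcases lt_trichotomy y s with h2 | h2 | h2
      · exfalso
        have h3 : (p : ℤ) ∣ ((i : ℤ) + 1) * ((s : ℤ) - y) := by
          exact aux_dvd hcong hd' 1 (-1) (by push_cast; ring)
        exact hsmall _ (by omega) (by omega) ((hP.dvd_or_dvd h3).resolve_left hni1)
      · rw [h2]
      · omega
    · exfalso
      have h2 : y < s := by omega
      obtain ⟨a, rfl⟩ := Nat.exists_eq_add_of_lt h1
      obtain ⟨b, rfl⟩ := Nat.exists_eq_add_of_lt h2
      have hba : a ≤ b := by omega
      refine hT' (a + 1) (b + 1) (by omega) (by omega) (aux_sq (by omega) hsp') (aux_sq (by omega) hsp') ?_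
      exact aux_dvd hd' hcong 1 (-1) (by push_cast; ring)
  have hex : ∃ xy, ValidPair p i xy ∧
      ∀ xy', ValidPair p i xy' → xy.1 + xy.2 ≤ xy'.1 + xy'.2 := by
    refine ⟨(r, s), hv, fun xy' h' => ?_⟩
    by_contra hlt
    push Not at hlt
    have := key xy' h' hlt.le
    subst this
    exact lt_irrefl _ hlt
  unfold minPair
  rw [dif_pos hex]
  exact key _ hex.choose_spec.1 (hex.choose_spec.2 _ hv)
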